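/- If a sequence (c_n) of positive reals satisfies c_{n+1}/c_n → 1 and there exist n₀ and b < 1/2 with c_{2n}/c_n ≤ b for all n ≥ n₀, then the series ∑ c_n converges. -/

import Mathlib

open Filter Topology

/-- If the terms `c (2 * n) + c (2 * n + 1)` are eventually at most `r * c n` with `r < 1`, then the
nonnegative sequence `c` is summable. -/
theorem summable_of_even_add_odd_le {c : ℕ → ℝ} (hc : ∀ n, 0 ≤ c n) {r : ℝ} (hr0 : 0 ≤ r)
    (hr1 : r < 1) {M : ℕ} (h : ∀ n ≥ M, c (2 * n) + c (2 * n + 1) ≤ r * c n) :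
    Summable c := by
  have hmono : Monotone fun N => ∑ i ∈ Finset.range N, c i := fun a b hab =>
    Finset.sum_le_sum_of_subset_of_nonneg (Finset.range_mono hab) fun i _ _ => hc i
  have hdouble (N : ℕ) : ∑ i ∈ Finset.range (2 * N), c i ≤
      ∑ i ∈ Finset.range (2 * M), c i + r * ∑ i ∈ Finset.range N, c i := by
    rcases le_total N M with hN | hN
    · have h1 := hmono (show 2 * N ≤ 2 * M by lia)
      have h2 := mul_nonneg hr0 (Finset.sum_nonneg fun i (_ : i ∈ Finset.range N) => hc i)
      dsimp only at h1
      linarith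
    · induction N, hN using Nat.le_induction with
      | base =>
        have := mul_nonneg hr0 (Finset.sum_nonneg fun i (_ : i ∈ Finset.range M) => hc i)
        linarith
      | succ N hN ih =>
        rw [show 2 * (N + 1) = 2 * N + 1 + 1 by ring]
        simp only [Finset.sum_range_succ]
        linarith [h N hN]
  refine summable_of_sum_range_le (c := (∑ i ∈ Finset.range (2 * M), c i) / (1 - r)) hc fun N => ?_
  rw [le_div_iff₀ (by linarith)]
  have h1 := hmono (show N ≤ 2 * N by lia)
  dsimp only at h1
  linarith [hdouble N]

theorem stmt_0 (c : ℕ → ℝ) (hpos : ∀ n, 0 < c n)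
    (hratio : Tendsto (fun n => c (n + 1) / c n) atTop (𝓝 1))
    (hb : ∃ (n₀ : ℕ) (b : ℝ), 0 < b ∧ b < 1 / 2 ∧ ∀ n ≥ n₀, c (2 * n) / c n ≤ b) :
    Summable c := by
  obtain ⟨n₀, b, hb0, hb1, hb⟩ := hb
  have hρ : 1 < 1 / (2 * b) := by
    rw [lt_div_iff₀ (by linarith)]
    linarith
  obtain ⟨n₁, hn₁⟩ := eventually_atTop.1 (hratio.eventually_lt_const hρ)
  refine summable_of_even_add_odd_le (r := b + 1 / 2) (M := max n₀ n₁) (fun n => (hpos n).le)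
    (by linarith) (by linarith) fun n hn => ?_
  have heven : c (2 * n) ≤ b * c n := (div_le_iff₀ (hpos n)).1 (hb n (by lia))
  have hodd : c (2 * n + 1) ≤ 1 / (2 * b) * c (2 * n) :=
    (div_le_iff₀ (hpos _)).1 (hn₁ (2 * n) (by lia)).le
  calc c (2 * n) + c (2 * n + 1) ≤ b * c n + 1 / (2 * b) * (b * c n) := by
        have : 1 / (2 * b) * c (2 * n) ≤ 1 / (2 * b) * (b * c n) := by gcongr
        linarith
    _ = (b + 1 / 2) * c n := by field_simp
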